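/- For every finite set P of n points in ℝ^d, there exists a sphere S and a set Γ ⊆ S with |Γ| = O(n^{1−1/d}) such that at least c·n points of P lie inside S, at least c·n points lie outside S (for a constant c > 0 depending only on d), and Γ is a Voronoi separator between the points of P inside S and those outside S: in Vor(P ∪ Γ), the Voronoi cells of points inside S are disjoint from the Voronoi cells of points outside S. -/

import Mathlib

open Metric

section VorHelpers

variable {E : Type*} [NormedAddCommGroup E] [InnerProductSpace ℝ E]

open scoped RealInnerProductSpace

/-- A finite set of unit vectors whose tangent halfspaces cut out a subset of the ball `√2`. -/
lemma vor_exists_dirs [FiniteDimensional ℝ E] :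
    ∃ U : Finset E, (∀ u ∈ U, ‖u‖ = 1) ∧ ∀ v : E, 2 < ‖v‖ ^ 2 → ∃ u ∈ U, 1 < ⟪u, v⟫ := by
  classical
  have hc : IsCompact (sphere (0 : E) 1) := isCompact_sphere 0 1
  obtain ⟨t, hts, htf, hcov⟩ := hc.finite_cover_balls (e := 1 / 2) (by norm_num)
  refine ⟨htf.toFinset, ?_, ?_⟩
  · intro u hu
    have := hts (htf.mem_toFinset.1 hu)
    simpa using this
  · intro v hv
    have hv0 : 0 < ‖v‖ := by
      rcases (norm_nonneg v).eq_or_lt with h | h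
      · rw [← h] at hv; norm_num at hv
      · exact h
    have hmem : (‖v‖⁻¹ • v) ∈ sphere (0 : E) 1 := by
      simp [norm_smul, hv0.ne']
    have := hcov hmem
    simp only [Set.mem_iUnion] at this
    obtain ⟨u, hu, hd⟩ := this
    refine ⟨u, htf.mem_toFinset.2 hu, ?_⟩
    have hu1 : ‖u‖ = 1 := by simpa using hts hu
    rw [mem_ball, dist_eq_norm] at hd
    have h1 : ‖‖v‖⁻¹ • v‖ = 1 := by simpa using hmem
    have h2 := norm_sub_sq_real (‖v‖⁻¹ • v) u
    rw [h1, hu1, real_inner_smul_left, real_inner_comm] at h2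
    have h3 : ‖‖v‖⁻¹ • v - u‖ ^ 2 < (1 / 2) ^ 2 := by
      apply pow_lt_pow_left₀ hd (norm_nonneg _) (by norm_num)
    have h4 : 7 / 8 < ‖v‖⁻¹ * ⟪u, v⟫ := by nlinarith
    have h5 : 7 / 8 * ‖v‖ < ⟪u, v⟫ := by
      rw [inv_mul_eq_div, lt_div_iff₀ hv0] at h4; exact h4
    have h6 : 8 / 7 < ‖v‖ := by nlinarith
    linarith

/-- Point on the sphere of radius `ρ` obtained from direction `u`, for the inside point `a • e`. -/
lemma vor_dir_point {e u : E} {a ρ : ℝ} (he : ‖e‖ = 1) (hu : ‖u‖ = 1) (ha : 0 ≤ a) (haρ : a < ρ) :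
    ∃ g : E, ‖g‖ = ρ ∧ ∀ x : E, 
      1 < ⟪u, (ρ⁻¹ - (Real.sqrt (ρ ^ 2 - a ^ 2))⁻¹) • ⟪(2 : ℝ) • x - a • e, e⟫ • e
        + (Real.sqrt (ρ ^ 2 - a ^ 2))⁻¹ • ((2 : ℝ) • x - a • e)⟫ → ‖x - g‖ < ‖x - a • e‖ := by
  have hρ : 0 < ρ := lt_of_le_of_lt ha haρ
  have hb2 : 0 < ρ ^ 2 - a ^ 2 := by nlinarith
  set b := Real.sqrt (ρ ^ 2 - a ^ 2) with hbdef
  have hb : 0 < b := Real.sqrt_pos.2 hb2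
  have hbsq : b ^ 2 = ρ ^ 2 - a ^ 2 := Real.sq_sqrt hb2.le
  set s := ⟪u, e⟫ with hs
  have hs1 : s ≤ 1 := by
    have := real_inner_le_norm u e; rw [he, hu] at this; linarith
  have hs2 : -1 ≤ s := by
    have := neg_le_of_abs_le (abs_real_inner_le_norm u e); rw [he, hu] at this; linarith
  set m : E := (ρ⁻¹ - b⁻¹) • s • e + b⁻¹ • u with hm
  have hee : ⟪e, e⟫ = 1 := by rw [real_inner_self_eq_norm_sq, he]; norm_num
  have huu : ⟪u, u⟫ = 1 := by rw [real_inner_self_eq_norm_sq, hu]; norm_num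
  have heu : ⟪e, u⟫ = s := by rw [real_inner_comm]
  have hem : ⟪e, m⟫ = s / ρ := by
    rw [hm, inner_add_right, inner_smul_right, inner_smul_right, inner_smul_right, hee, heu]
    field_simp; ring
  have hmm : ‖m‖ ^ 2 = s ^ 2 / ρ ^ 2 + (1 - s ^ 2) / b ^ 2 := by
    rw [← real_inner_self_eq_norm_sq, hm]
    simp only [inner_add_right, inner_add_left, real_inner_smul_left, real_inner_smul_right, hee,
      huu, heu, ← hs]
    field_simp; ring
  have hmpos : 0 < ‖m‖ ^ 2 := by
    rw [hmm]
    have : 0 ≤ 1 - s ^ 2 := by nlinarith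
    by_cases h0 : s = 0
    · rw [h0]; simp; positivity
    · have : 0 < s ^ 2 := by positivity
      positivity
  set τ := (1 - a * s / ρ) / ‖m‖ ^ 2 with hτ
  have hsa : a * s / ρ < 1 := by
    rw [div_lt_one hρ]; nlinarith
  have hτpos : 0 < τ := div_pos (by linarith) hmpos
  have hτm : τ * ‖m‖ ^ 2 = 1 - a * s / ρ := by rw [hτ, div_mul_cancel₀ _ hmpos.ne']
  refine ⟨a • e + τ • m, ?_, ?_⟩
  · have h1 : ‖a • e + τ • m‖ ^ 2 = ρ ^ 2 := by
      rw [norm_add_sq_real, norm_smul, norm_smul, he, real_inner_smul_left, inner_smul_right, hem,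
        mul_pow, mul_pow, Real.norm_eq_abs, Real.norm_eq_abs, sq_abs, sq_abs]
      have h2 : τ ^ 2 * ‖m‖ ^ 2 = τ * (1 - a * s / ρ) := by rw [← hτm]; ring
      rw [h2]
      have h3 : ‖m‖ ^ 2 * b ^ 2 = (1 - a * s / ρ) * (1 + a * s / ρ) := by
        rw [hmm]; field_simp; rw [hbsq]; ring
      have h4 : τ * (1 + a * s / ρ) = b ^ 2 := by
        rw [hτ, div_mul_eq_mul_div, ← h3, mul_div_cancel_left₀ _ hmpos.ne']
      have : τ * (1 + a * s / ρ) = ρ ^ 2 - a ^ 2 := by rw [h4, hbsq]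
      linear_combination this
    exact (pow_left_inj₀ (norm_nonneg _) hρ.le two_ne_zero).1 h1
  · intro x hx
    have hsym : ⟪u, (ρ⁻¹ - b⁻¹) • ⟪(2 : ℝ) • x - a • e, e⟫ • e + b⁻¹ • ((2 : ℝ) • x - a • e)⟫
        = ⟪m, (2 : ℝ) • x - a • e⟫ := by
      rw [hm]
      generalize (2 : ℝ) • x - a • e = z
      simp only [inner_add_right, inner_add_left, real_inner_smul_left, real_inner_smul_right, ← hs]
      rw [real_inner_comm e z]; ring
    rw [hsym] at hx
    have hx2 : ⟪m, (2 : ℝ) • x - a • e⟫ = 2 * ⟪m, x - a • e⟫ + a * s / ρ := by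
      simp only [inner_sub_right, real_inner_smul_right]
      rw [real_inner_comm e m, hem]; ring
    rw [hx2] at hx
    apply lt_of_pow_lt_pow_left₀ 2 (norm_nonneg _)
    have : x - (a • e + τ • m) = (x - a • e) - τ • m := by abel
    rw [this, norm_sub_sq_real, norm_smul, inner_smul_right, mul_pow, Real.norm_eq_abs, sq_abs,
      real_inner_comm]
    have h2 : τ ^ 2 * ‖m‖ ^ 2 = τ * (1 - a * s / ρ) := by rw [← hτm]; ring
    rw [h2]
    nlinarith

lemma vor_poly_ineq {a ρ ζ Z : ℝ} (ha : 0 ≤ a) (haρ : a < ρ) (hζ : ζ ≤ ρ) (hZ : ζ ^ 2 ≤ Z)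
    (h : 4 * ρ ^ 2 ≤ Z + 2 * a * ζ + a ^ 2) :
    2 < ζ ^ 2 / ρ ^ 2 + (Z - ζ ^ 2) / (ρ ^ 2 - a ^ 2) := by
  have hρ : 0 < ρ := lt_of_le_of_lt ha haρ
  have hb2 : 0 < ρ ^ 2 - a ^ 2 := by nlinarith
  rw [div_add_div _ _ (by positivity) hb2.ne', lt_div_iff₀ (by positivity)]
  by_cases h3 : ζ < -3 * ρ
  · have : 2 * ρ ^ 2 < ζ ^ 2 := by nlinarith
    have h5 : 0 ≤ ρ ^ 2 * (Z - ζ ^ 2) := mul_nonneg (by positivity) (by linarith)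
    nlinarith
  · push Not at h3
    have h4 : 0 ≤ a ^ 2 * ((ρ - ζ) * (ζ + 3 * ρ)) :=
      mul_nonneg (by positivity) (mul_nonneg (by linarith) (by linarith))
    have h5 : 0 ≤ ρ ^ 2 * (Z + 2 * a * ζ + a ^ 2 - 4 * ρ ^ 2) :=
      mul_nonneg (by positivity) (by linarith)
    have h6 : 0 ≤ (ρ - a) * (a * (ρ - ζ)) * ρ := by
      have : 0 ≤ ρ - ζ := by linarith
      have : 0 ≤ ρ - a := by linarith
      positivity
    have h7 : 0 < ρ ^ 3 * (ρ - a) := mul_pos (by positivity) (by linarith)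
    nlinarith

lemma vor_local0 [FiniteDimensional ℝ E] [Nontrivial E] :
    ∃ M : ℕ, ∀ (ρ : ℝ) (q : E), 0 < ρ → ∃ F : Finset E, F.card ≤ M ∧ (∀ g ∈ F, ‖g‖ = ρ) ∧
      (∃ g ∈ F, ‖q - g‖ = |‖q‖ - ρ|) ∧
      (‖q‖ < ρ → ∀ x : E, ρ ≤ ‖x‖ → ∃ g ∈ F, ‖x - g‖ < ‖x - q‖) ∧
      (ρ < ‖q‖ → ∀ x : E, ‖x‖ ≤ ρ → ∃ g ∈ F, ‖x - g‖ < ‖x - q‖) := by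
  classical
  obtain ⟨U, hU1, hU⟩ := vor_exists_dirs (E := E)
  refine ⟨U.card + 1, fun ρ q hρ => ?_⟩
  obtain ⟨e, he, hqe⟩ : ∃ e : E, ‖e‖ = 1 ∧ q = ‖q‖ • e := by
    by_cases h0 : q = 0
    · obtain ⟨e, he⟩ := exists_norm_eq E (zero_le_one (α := ℝ))
      exact ⟨e, he, by simp [h0]⟩
    · have : ‖q‖ ≠ 0 := by simpa using h0
      refine ⟨‖q‖⁻¹ • q, by simp [norm_smul, this], ?_⟩
      rw [smul_smul, mul_inv_cancel₀ this, one_smul]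
  have ha : 0 ≤ ‖q‖ := norm_nonneg q
  generalize ‖q‖ = a at hqe ha ⊢
  subst hqe
  have hee : ⟪e, e⟫ = 1 := by rw [real_inner_self_eq_norm_sq, he]; norm_num
  have hn : ‖ρ • e‖ = ρ := by rw [norm_smul, he, Real.norm_eq_abs, abs_of_pos hρ, mul_one]
  have hi : ‖a • e - ρ • e‖ = |a - ρ| := by
    rw [← sub_smul, norm_smul, he, Real.norm_eq_abs, mul_one]
  have hcmp : ∀ x : E, ‖x - ρ • e‖ ^ 2 - ‖x - a • e‖ ^ 2 = (ρ - a) * (ρ + a - 2 * ⟪x, e⟫) := by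
    intro x
    rw [norm_sub_sq_real, norm_sub_sq_real, inner_smul_right, inner_smul_right, norm_smul,
      norm_smul, he, Real.norm_eq_abs, Real.norm_eq_abs, mul_one, mul_one, sq_abs, sq_abs]
    ring
  by_cases haρ : a < ρ
  · have hg : ∀ u : U, _ := fun u => vor_dir_point (e := e) (u := u) he (hU1 u u.2) ha haρ
    choose g hg1 hg2 using hg
    refine ⟨insert (ρ • e) (Finset.univ.image g), ?_, ?_, ⟨_, Finset.mem_insert_self _ _, hi⟩, ?_, ?_⟩
    · refine (Finset.card_insert_le _ _).trans ?_
      have := Finset.card_image_le (s := (Finset.univ : Finset U)) (f := g)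
      simp at this
      simpa using this
    · intro y hy
      rcases Finset.mem_insert.1 hy with rfl | hy
      · exact hn
      · obtain ⟨u, -, rfl⟩ := Finset.mem_image.1 hy
        exact hg1 u
    · intro _ x hx
      by_cases hc : ρ + a < 2 * ⟪x, e⟫
      · refine ⟨_, Finset.mem_insert_self _ _, ?_⟩
        apply lt_of_pow_lt_pow_left₀ 2 (norm_nonneg _)
        have := hcmp x
        nlinarith
      · push Not at hc
        have hb2 : 0 < ρ ^ 2 - a ^ 2 := by nlinarith
        have hb : 0 < Real.sqrt (ρ ^ 2 - a ^ 2) := Real.sqrt_pos.2 hb2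
        have hbsq : Real.sqrt (ρ ^ 2 - a ^ 2) ^ 2 = ρ ^ 2 - a ^ 2 := Real.sq_sqrt hb2.le
        suffices h : ∃ u ∈ U, 1 < ⟪u, (ρ⁻¹ - (Real.sqrt (ρ ^ 2 - a ^ 2))⁻¹) • 
            ⟪(2 : ℝ) • x - a • e, e⟫ • e
              + (Real.sqrt (ρ ^ 2 - a ^ 2))⁻¹ • ((2 : ℝ) • x - a • e)⟫ by
          obtain ⟨u, hu, hlt⟩ := h
          exact ⟨g ⟨u, hu⟩, Finset.mem_insert_of_mem (Finset.mem_image_of_mem _ (Finset.mem_univ _)),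
            hg2 ⟨u, hu⟩ x hlt⟩
        apply hU
        set z := (2 : ℝ) • x - a • e with hz
        set b := Real.sqrt (ρ ^ 2 - a ^ 2)
        have hζ : ⟪z, e⟫ ≤ ρ := by
          rw [hz, inner_sub_left, real_inner_smul_left, real_inner_smul_left, hee]; linarith
        have hZ : ⟪z, e⟫ ^ 2 ≤ ‖z‖ ^ 2 := by
          have := abs_real_inner_le_norm z e
          rw [he, mul_one] at this
          rw [← sq_abs]; gcongr
        have h4 : 4 * ρ ^ 2 ≤ ‖z‖ ^ 2 + 2 * a * ⟪z, e⟫ + a ^ 2 := by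
          have h5 : ‖z + a • e‖ ^ 2 = ‖z‖ ^ 2 + 2 * a * ⟪z, e⟫ + a ^ 2 := by
            rw [norm_add_sq_real, inner_smul_right, norm_smul, he, Real.norm_eq_abs, mul_one, sq_abs]
            ring
          rw [← h5, hz, sub_add_cancel, norm_smul]
          norm_num
          nlinarith
        have hfin := vor_poly_ineq ha haρ hζ hZ h4
        rw [← hbsq] at hfin
        refine hfin.trans_eq ?_
        rw [← real_inner_self_eq_norm_sq (_ + _)]
        simp only [inner_add_right, inner_add_left, real_inner_smul_left, real_inner_smul_right, hee,
          real_inner_self_eq_norm_sq z, real_inner_comm z e]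
        field_simp; ring
    · intro h; linarith
  · refine ⟨{ρ • e}, by simp, by simpa using hn, ⟨_, Finset.mem_singleton_self _, hi⟩, 
      fun h => absurd h haρ, fun h x hx => ⟨_, Finset.mem_singleton_self _, ?_⟩⟩
    apply lt_of_pow_lt_pow_left₀ 2 (norm_nonneg _)
    have := hcmp x
    have h2 := real_inner_le_norm x e
    rw [he, mul_one] at h2
    nlinarith

lemma vor_local [FiniteDimensional ℝ E] [Nontrivial E] :
    ∃ M : ℕ, ∀ (c : E) (ρ : ℝ) (q : E), 0 < ρ → ∃ F : Finset E, F.card ≤ M ∧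
      (∀ g ∈ F, dist g c = ρ) ∧
      (∃ g ∈ F, dist q g = |dist q c - ρ|) ∧
      (dist q c < ρ → ∀ x : E, ρ ≤ dist x c → ∃ g ∈ F, dist x g < dist x q) ∧
      (ρ < dist q c → ∀ x : E, dist x c ≤ ρ → ∃ g ∈ F, dist x g < dist x q) := by
  classical
  obtain ⟨M, hM⟩ := vor_local0 (E := E)
  refine ⟨M, fun c ρ q hρ => ?_⟩
  obtain ⟨F, h1, h2, ⟨g, hg, hgq⟩, h4, h5⟩ := hM ρ (q - c) hρ
  have key : ∀ x y : E, dist x (y + c) = ‖(x - c) - y‖ := by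
    intro x y; rw [dist_eq_norm]; congr 1; abel
  have key2 : ∀ x y : E, dist x y = ‖(x - c) - (y - c)‖ := by
    intro x y; rw [dist_eq_norm]; congr 1; abel
  refine ⟨F.image (· + c), Finset.card_image_le.trans h1, ?_, ?_, ?_, ?_⟩
  · intro y hy
    obtain ⟨z, hz, rfl⟩ := Finset.mem_image.1 hy
    simpa [dist_eq_norm] using h2 z hz
  · refine ⟨g + c, Finset.mem_image_of_mem _ hg, ?_⟩
    rw [key, hgq, dist_eq_norm]
  · intro h x hx
    rw [dist_eq_norm] at h hx
    obtain ⟨y, hy, hlt⟩ := h4 h (x - c) hx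
    exact ⟨y + c, Finset.mem_image_of_mem _ hy, by rw [key, key2 x q]; exact hlt⟩
  · intro h x hx
    rw [dist_eq_norm] at h hx
    obtain ⟨y, hy, hlt⟩ := h5 h (x - c) hx
    exact ⟨y + c, Finset.mem_image_of_mem _ hy, by rw [key, key2 x q]; exact hlt⟩

end VorHelpers

section VorHelpers2

lemma vor_grid (d : ℕ) (hd : 1 ≤ d) :
    ∃ C : ℝ, 0 ≤ C ∧ ∀ (c : EuclideanSpace ℝ (Fin d)) (r : ℝ) (m : ℕ), 0 < r → 1 ≤ m →
      ∃ G : Finset (EuclideanSpace ℝ (Fin d)), (G.card : ℝ) ≤ C * (m : ℝ) ^ d ∧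
        ∀ y ∈ closedBall c (2 * r), ∃ g ∈ G, dist y g ≤ r / (16 * m) := by
  classical
  refine ⟨(80 * d : ℝ) ^ d, by positivity, fun c r m hr hm => ?_⟩
  set h : ℝ := r / (16 * d * m) with hh
  have hd' : (0 : ℝ) < d := by exact_mod_cast hd
  have hm' : (0 : ℝ) < m := by exact_mod_cast hm
  have hpos : 0 < h := by positivity
  set N : ℤ := 32 * d * m with hN
  let f : (Fin d → ℤ) → EuclideanSpace ℝ (Fin d) := fun k =>
    WithLp.toLp 2 (fun i => c i + h * (k i : ℝ))
  refine ⟨(Fintype.piFinset (fun _ : Fin d => Finset.Icc (-N) N)).image f, ?_, ?_⟩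
  · have h1 : ((Fintype.piFinset (fun _ : Fin d => Finset.Icc (-N) N)).image f).card
        ≤ (64 * d * m + 1) ^ d := by
      refine Finset.card_image_le.trans ?_
      rw [Fintype.card_piFinset]
      simp only [Int.card_Icc, Finset.prod_const, Finset.card_univ, Fintype.card_fin]
      apply Nat.pow_le_pow_left
      have : (N + 1 - -N) = ((64 * d * m + 1 : ℕ) : ℤ) := by rw [hN]; push_cast; ring
      rw [this, Int.toNat_natCast]
    have h2 : (64 * d * m + 1) ^ d ≤ (80 * d * m) ^ d := by
      apply Nat.pow_le_pow_left
      have : 1 ≤ d * m := Nat.mul_pos hd hm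
      nlinarith
    have h3 := h1.trans h2
    rw [← mul_pow]
    exact_mod_cast h3
  · intro y hy
    rw [mem_closedBall] at hy
    refine ⟨f (fun i => ⌊(y i - c i) / h⌋), Finset.mem_image_of_mem _ ?_, ?_⟩
    · rw [Fintype.mem_piFinset]
      intro i
      have h1 : |y i - c i| ≤ 2 * r := by
        have := PiLp.norm_apply_le (y - c) i
        rw [dist_eq_norm] at hy
        simpa using this.trans hy
      have h2 : (2 * r) / h = 32 * d * m := by rw [hh]; field_simp; norm_num
      obtain ⟨h3, h4⟩ := abs_le.1 h1
      rw [Finset.mem_Icc]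
      constructor
      · rw [Int.le_floor, hN]
        push_cast
        rw [← h2, ← neg_div]
        gcongr
      · have : ((⌊(y i - c i) / h⌋ : ℤ) : ℝ) ≤ (N : ℝ) := by
          refine (Int.floor_le _).trans ?_
          rw [hN]; push_cast; rw [← h2]; gcongr
        exact_mod_cast this
    · rw [EuclideanSpace.dist_eq]
      have h1 : ∀ i, dist (y i) (f (fun i => ⌊(y i - c i) / h⌋) i) ≤ h := by
        intro i
        have h2 := Int.floor_le ((y i - c i) / h)
        have h3 := Int.lt_floor_add_one ((y i - c i) / h)
        rw [le_div_iff₀ hpos] at h2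
        rw [div_lt_iff₀ hpos] at h3
        simp only [f, Real.dist_eq]
        rw [abs_le]
        constructor <;> linarith
      have h4 : ∑ i, dist (y i) (f (fun i => ⌊(y i - c i) / h⌋) i) ^ 2 ≤ (d * h) ^ 2 := by
        calc _ ≤ ∑ i : Fin d, h ^ 2 := by
              apply Finset.sum_le_sum; intro i _
              exact pow_le_pow_left₀ dist_nonneg (h1 i) 2
          _ = d * h ^ 2 := by simp
          _ ≤ _ := by
            have : (1 : ℝ) ≤ d := by exact_mod_cast hd
            rw [mul_pow]; nlinarith [mul_nonneg (sub_nonneg.2 this) hd'.le, sq_nonneg h]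
      refine (Real.sqrt_le_sqrt h4).trans ?_
      rw [Real.sqrt_sq (by positivity), hh]
      apply le_of_eq
      field_simp

lemma vor_start {E : Type*} [NormedAddCommGroup E] [NormedSpace ℝ E] [FiniteDimensional ℝ E] :
    ∃ C : ℕ, 1 ≤ C ∧ ∀ (P : Finset E) (k : ℕ), 2 ≤ k → k ≤ P.card →
      ∃ (c : E) (r : ℝ), 0 < r ∧ k ≤ (↑P ∩ closedBall c r : Set E).ncard ∧
        (↑P ∩ closedBall c (2 * r) : Set E).ncard ≤ C * k := by
  classical
  have hc : IsCompact (closedBall (0 : E) 2) := isCompact_closedBall 0 2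
  obtain ⟨t, -, htf, hcov⟩ := hc.finite_cover_balls (e := 1 / 2) (by norm_num)
  refine ⟨htf.toFinset.card + 1, by omega, fun P k hk hkP => ?_⟩
  have hfin : ∀ s : Set E, (↑P ∩ s : Set E).Finite := fun s => P.finite_toSet.inter_of_left s
  obtain ⟨R, hR0, hR⟩ := P.finite_toSet.isBounded.subset_closedBall_lt 0 (0 : E)
  let S : ℕ → Prop := fun j => ∃ c : E, k ≤ (↑P ∩ closedBall c (R / 2 ^ j) : Set E).ncard
  have hS0 : S 0 := ⟨0, by
    rw [pow_zero, div_one, Set.inter_eq_left.2 hR, Set.ncard_coe_finset]; exact hkP⟩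
  have hSfalse : ∃ j, ¬ S j := by
    obtain ⟨δ, hδ, hsep⟩ : ∃ δ : ℝ, 0 < δ ∧ ∀ p ∈ P, ∀ q ∈ P, p ≠ q → δ ≤ dist p q := by
      by_cases hne : P.offDiag.Nonempty
      · obtain ⟨z, hz, hmin⟩ := P.offDiag.exists_min_image (fun z => dist z.1 z.2) hne
        refine ⟨dist z.1 z.2, dist_pos.2 (Finset.mem_offDiag.1 hz).2.2, fun p hp q hq hpq => ?_⟩
        exact hmin (p, q) (Finset.mem_offDiag.2 ⟨hp, hq, hpq⟩)
      · refine ⟨1, one_pos, fun p hp q hq hpq => ?_⟩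
        exact absurd ⟨(p, q), Finset.mem_offDiag.2 ⟨hp, hq, hpq⟩⟩ hne
    obtain ⟨j, hj⟩ := exists_pow_lt_of_lt_one (show 0 < δ / (2 * R) by positivity)
      (show (1 / 2 : ℝ) < 1 by norm_num)
    refine ⟨j, ?_⟩
    rintro ⟨c, hc⟩
    have h1 : 1 < (↑P ∩ closedBall c (R / 2 ^ j) : Set E).ncard := by omega
    rw [Set.one_lt_ncard (hfin _)] at h1
    obtain ⟨p, hp, q, hq, hpq⟩ := h1
    have h2 := hsep p hp.1 q hq.1 hpq
    have h3 := dist_triangle_right p q c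
    have h4 := hp.2
    have h5 := hq.2
    rw [mem_closedBall] at h4 h5
    have h6 : 2 * (R / 2 ^ j) < δ := by
      rw [one_div, inv_pow, lt_div_iff₀ (by positivity)] at hj
      calc 2 * (R / 2 ^ j) = (2 ^ j)⁻¹ * (2 * R) := by ring
        _ < δ := hj
    linarith
  set j := Nat.find hSfalse with hj
  have hjn : ¬ S j := Nat.find_spec hSfalse
  have hj0 : j ≠ 0 := fun h => hjn (h ▸ hS0)
  obtain ⟨i, hi⟩ := Nat.exists_eq_succ_of_ne_zero hj0
  have hSi : S i := by
    have := Nat.find_min hSfalse (m := i) (by omega)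
    exact not_not.1 this
  obtain ⟨c, hc⟩ := hSi
  set r := R / 2 ^ i with hr
  have hrpos : 0 < r := by positivity
  refine ⟨c, r, hrpos, hc, ?_⟩
  have hsub : (↑P ∩ closedBall c (2 * r) : Set E) ⊆
      ⋃ y ∈ htf.toFinset, (↑P ∩ closedBall (c + r • y) (R / 2 ^ j) : Set E) := by
    rintro p ⟨hp, hpb⟩
    have h1 : r⁻¹ • (p - c) ∈ closedBall (0 : E) 2 := by
      rw [mem_closedBall, dist_eq_norm] at *
      rw [sub_zero, norm_smul, norm_inv, Real.norm_eq_abs, abs_of_pos hrpos, inv_mul_le_iff₀ hrpos]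
      linarith
    have h2 := hcov h1
    simp only [Set.mem_iUnion] at h2 ⊢
    obtain ⟨y, hy, hyb⟩ := h2
    refine ⟨y, htf.mem_toFinset.2 hy, hp, ?_⟩
    rw [mem_ball, dist_eq_norm] at hyb
    rw [mem_closedBall, dist_eq_norm]
    have h3 : p - (c + r • y) = r • (r⁻¹ • (p - c) - y) := by
      rw [smul_sub, smul_smul, mul_inv_cancel₀ hrpos.ne', one_smul]; abel
    rw [h3, norm_smul, Real.norm_eq_abs, abs_of_pos hrpos, hi, Nat.succ_eq_add_one, pow_succ, 
      ← div_div, ← hr]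
    nlinarith
  have hfin2 : (⋃ y ∈ htf.toFinset, (↑P ∩ closedBall (c + r • y) (R / 2 ^ j) : Set E)).Finite :=
    Set.Finite.biUnion htf.toFinset.finite_toSet (fun y _ => hfin _)
  refine (Set.ncard_le_ncard hsub hfin2).trans ?_
  refine (Finset.set_ncard_biUnion_le _ _).trans ?_
  have : ∀ y ∈ htf.toFinset, (↑P ∩ closedBall (c + r • y) (R / 2 ^ j) : Set E).ncard ≤ k := by
    intro y _
    by_contra hcon
    exact hjn ⟨_, (not_le.1 hcon).le⟩
  refine (Finset.sum_le_card_nsmul _ _ _ this).trans ?_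
  rw [smul_eq_mul]
  gcongr
  omega

end VorHelpers2

set_option maxHeartbeats 2000000

/-- Main separator theorem: for every `d` there are constants `A, c > 0` and a threshold
`n₀` such that every finite `P ⊆ ℝ^d` with `|P| ≥ n₀` admits a sphere `S` and a set
`Γ ⊆ S` with `|Γ| ≤ A · |P|^(1−1/d)`, at least `c·|P|` points of `P` inside `S`, at least
`c·|P|` points outside `S`, and `Γ` Voronoi separates the inside points from the outside
points in `Vor(P ∪ Γ)`. -/
theorem voronoi_separator_exists (d : ℕ) (hd : 1 ≤ d) :
    ∃ (A c : ℝ) (n₀ : ℕ), 0 < A ∧ 0 < c ∧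
      ∀ P : Finset (EuclideanSpace ℝ (Fin d)), n₀ ≤ P.card →
        ∃ (ctr : EuclideanSpace ℝ (Fin d)) (ρ : ℝ) (Γ : Finset (EuclideanSpace ℝ (Fin d))),
          0 < ρ ∧
          ↑Γ ⊆ sphere ctr ρ ∧
          (Γ.card : ℝ) ≤ A * (P.card : ℝ) ^ ((1 : ℝ) - 1 / d) ∧
          c * P.card ≤ ((↑P ∩ closedBall ctr ρ : Set _).ncard : ℝ) ∧
          c * P.card ≤ ((↑P \ closedBall ctr ρ : Set _).ncard : ℝ) ∧
          ∀ p₁ ∈ P, dist p₁ ctr ≤ ρ → ∀ p₂ ∈ P, ρ < dist p₂ ctr →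
            {x : EuclideanSpace ℝ (Fin d) |
                ∀ q ∈ (↑P : Set _) ∪ ↑Γ, dist x p₁ ≤ dist x q} ∩
            {x : EuclideanSpace ℝ (Fin d) |
                ∀ q ∈ (↑P : Set _) ∪ ↑Γ, dist x p₂ ≤ dist x q} = ∅ := by
  classical
  have : Nonempty (Fin d) := ⟨⟨0, hd⟩⟩
  have : Nontrivial (EuclideanSpace ℝ (Fin d)) := by
    refine ⟨EuclideanSpace.single ⟨0, hd⟩ (1 : ℝ), 0, fun h => ?_⟩
    have := congrArg norm h
    simp at this
  obtain ⟨M, hM⟩ := vor_local (E := EuclideanSpace ℝ (Fin d))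
  obtain ⟨C, hC0, hgrid⟩ := vor_grid d hd
  obtain ⟨K, hK1, hstart⟩ := vor_start (E := EuclideanSpace ℝ (Fin d))
  have hK : (1 : ℝ) ≤ K := by exact_mod_cast hK1
  refine ⟨M * (1 + C * 2 ^ d) + 1, 1 / (4 * K), 4 * K, by positivity, by positivity,
    fun P hP => ?_⟩
  set n := P.card with hn
  have hnK : (4 * K : ℝ) ≤ n := by exact_mod_cast hP
  have hn1 : (1 : ℝ) ≤ n := by linarith
  set k := ⌈(n : ℝ) / (2 * K)⌉₊ with hk
  have hkge : (n : ℝ) / (2 * K) ≤ k := Nat.le_ceil _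
  have hklt : (k : ℝ) < n / (2 * K) + 1 := Nat.ceil_lt_add_one (by positivity)
  have hk2 : 2 ≤ k := by
    have : (2 : ℝ) ≤ k := by
      refine le_trans ?_ hkge
      rw [le_div_iff₀ (by positivity)]; linarith
    exact_mod_cast this
  have hKk : (K : ℝ) * k ≤ n / 2 + K := by
    have := mul_le_mul_of_nonneg_left hklt.le (show (0 : ℝ) ≤ K by linarith)
    have h2 : (K : ℝ) * (n / (2 * K) + 1) = n / 2 + K := by field_simp
    linarith
  have hkn : k ≤ n := by
    have : (k : ℝ) ≤ n := by nlinarith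
    exact_mod_cast this
  obtain ⟨c, r, hr, hin, hout⟩ := hstart P k hk2 hkn
  -- the number of shells
  set N : ℝ := (n : ℝ) ^ ((1 : ℝ) / d) with hN
  have hd' : (0 : ℝ) < d := by exact_mod_cast hd
  have hN1 : 1 ≤ N := Real.one_le_rpow hn1 (by positivity)
  have hNd : N ^ d = n := by
    rw [hN, ← Real.rpow_natCast, ← Real.rpow_mul (by positivity), one_div_mul_cancel hd'.ne',
      Real.rpow_one]
  set m := ⌈N⌉₊ with hm
  have hmN : N ≤ m := Nat.le_ceil _
  have hm2 : (m : ℝ) ≤ 2 * N := by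
    have := Nat.ceil_lt_add_one (show 0 ≤ N by linarith)
    rw [← hm] at this; linarith
  have hm' : (1 : ℝ) ≤ m := by linarith
  have hm1 : 1 ≤ m := by exact_mod_cast hm'
  have hm0 : (0 : ℝ) < m := by linarith
  obtain ⟨G, hGcard, hG⟩ := hgrid c r m hr hm1
  set Q := P ∪ G with hQ
  have hQcard : (Q.card : ℝ) ≤ (1 + C * 2 ^ d) * n := by
    have h1 : (Q.card : ℝ) ≤ n + G.card := by exact_mod_cast Finset.card_union_le P G
    have h2 : (m : ℝ) ^ d ≤ 2 ^ d * n := by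
      calc (m : ℝ) ^ d ≤ (2 * N) ^ d := by gcongr
        _ = _ := by rw [mul_pow, hNd]
    have h3 := mul_le_mul_of_nonneg_left h2 hC0
    linarith
  obtain ⟨j, hj, hjcard⟩ := Finset.exists_card_fiber_le_of_card_le_nsmul (s := Q)
    (t := Finset.range m) (f := fun q => ⌊m * (dist q c - r) / r⌋₊) (b := (Q.card : ℝ) / m)
    (by simpa using (by omega : m ≠ 0))
    (by rw [Finset.card_range, nsmul_eq_mul, mul_div_cancel₀ _ hm0.ne'])
  set W := Q.filter (fun q => ⌊m * (dist q c - r) / r⌋₊ = j) with hW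
  have hjm : (j : ℝ) + 1 ≤ m := by
    have := Finset.mem_range.1 hj
    exact_mod_cast this
  -- the radius
  obtain ⟨ρ, hρI, hρP⟩ : ∃ ρ ∈ Set.Ioo (r * (1 + (j + 1 / 4) / m)) (r * (1 + (j + 3 / 4) / m)),
      ρ ∉ ((P.image (fun p => dist p c) : Finset ℝ) : Set ℝ) := by
    have hlt : r * (1 + ((j : ℝ) + 1 / 4) / m) < r * (1 + (j + 3 / 4) / m) := by
      gcongr; norm_num
    exact (Set.Ioo_infinite hlt).exists_notMem_finset _
  have hρP' : ∀ p ∈ P, dist p c ≠ ρ := by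
    intro p hp h
    exact hρP (Finset.mem_coe.2 (Finset.mem_image.2 ⟨p, hp, h⟩))
  have hρ1 : r * m + r * (j + 1 / 4) < ρ * m := by
    have := mul_lt_mul_of_pos_right hρI.1 hm0
    have h2 : r * (1 + ((j : ℝ) + 1 / 4) / m) * m = r * m + r * (j + 1 / 4) := by field_simp
    linarith
  have hρ2 : ρ * m < r * m + r * (j + 3 / 4) := by
    have := mul_lt_mul_of_pos_right hρI.2 hm0
    have h2 : r * (1 + ((j : ℝ) + 3 / 4) / m) * m = r * m + r * (j + 3 / 4) := by field_simp
    linarith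
  have hj0 : (0 : ℝ) ≤ j := Nat.cast_nonneg j
  have hrρ : r < ρ := by
    have : r * m < ρ * m := by nlinarith
    exact lt_of_mul_lt_mul_right this hm0.le
  have hρ2r : ρ ≤ 2 * r := by
    have : ρ * m ≤ 2 * r * m := by nlinarith
    exact le_of_mul_le_mul_right this hm0
  have hρ : 0 < ρ := hr.trans hrρ
  have hnear : ∀ q ∈ Q, |dist q c - ρ| < r / (4 * m) → q ∈ W := by
    intro q hq hlt
    rw [hW, Finset.mem_filter]
    refine ⟨hq, ?_⟩
    rw [lt_div_iff₀ (by positivity)] at hlt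
    have h1 : (dist q c - ρ) * (4 * m) < r :=
      lt_of_le_of_lt (mul_le_mul_of_nonneg_right (le_abs_self _) (by positivity)) hlt
    have h2 : -(dist q c - ρ) * (4 * m) < r :=
      lt_of_le_of_lt (mul_le_mul_of_nonneg_right (neg_le_abs _) (by positivity)) hlt
    have h3 : (j : ℝ) ≤ m * (dist q c - r) / r := by
      rw [le_div_iff₀ hr]; linarith
    rw [Nat.floor_eq_iff (hj0.trans h3)]
    refine ⟨h3, ?_⟩
    rw [div_lt_iff₀ hr]; linarith
  choose F hFcard hFsph hFproj hFin hFout using fun q => hM c ρ q hρ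
  set Γ := W.biUnion F with hΓ
  have hΓsph : ∀ g ∈ Γ, dist g c = ρ := by
    intro g hg
    obtain ⟨q, -, hgq⟩ := Finset.mem_biUnion.1 hg
    exact hFsph q g hgq
  -- Γ is a net on the sphere
  have hnet : ∀ s, dist s c = ρ → ∃ g ∈ Γ, dist s g < r / (4 * m) := by
    intro s hs
    obtain ⟨g, hg, hsg⟩ := hG s (by rw [mem_closedBall, hs]; exact hρ2r)
    have h1 : |dist g c - ρ| ≤ r / (16 * m) := by
      rw [← hs]
      refine (abs_dist_sub_le g s c).trans ?_
      rw [dist_comm]; exact hsg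
    have h0 : 0 < r / m := by positivity
    have h16 : r / (16 * m) = r / m / 16 := by field_simp
    have h4 : r / (4 * m) = r / m / 4 := by field_simp
    obtain ⟨y, hy, hgy⟩ := hFproj g
    refine ⟨y, Finset.mem_biUnion.2 ⟨g, hnear g (Finset.mem_union_right _ hg) (by linarith), hy⟩, ?_⟩
    have := dist_triangle s g y
    linarith
  have hnet2 : ∀ x, ∃ g ∈ Γ, dist x g < |dist x c - ρ| + r / (4 * m) := by
    intro x
    obtain ⟨y, hy, hxy⟩ := hFproj x
    obtain ⟨g, hg, hyg⟩ := hnet y (hFsph x y hy)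
    refine ⟨g, hg, ?_⟩
    have := dist_triangle x y g
    linarith
  refine ⟨c, ρ, Γ, hρ, ?_, ?_, ?_, ?_, ?_⟩
  · intro g hg
    exact hΓsph g (Finset.mem_coe.1 hg)
  · have h1 : (Γ.card : ℝ) ≤ W.card * M := by
      exact_mod_cast Finset.card_biUnion_le_card_mul W F M (fun q _ => hFcard q)
    have h2 : (n : ℝ) ^ ((1 : ℝ) - 1 / d) = n / N := by
      rw [Real.rpow_sub (by linarith), Real.rpow_one]
    have h3 : (Q.card : ℝ) / m ≤ (1 + C * 2 ^ d) * n / N := by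
      gcongr
    have h4 : (W.card : ℝ) ≤ (1 + C * 2 ^ d) * n / N := hjcard.trans h3
    rw [h2]
    have h5 : 0 ≤ (n : ℝ) / N := by positivity
    calc (Γ.card : ℝ) ≤ W.card * M := h1
      _ ≤ (1 + C * 2 ^ d) * n / N * M := by gcongr
      _ = M * (1 + C * 2 ^ d) * (n / N) := by ring
      _ ≤ _ := by rw [add_mul (_ * _)]; linarith
  · have h1 : k ≤ (↑P ∩ closedBall c ρ : Set _).ncard :=
      hin.trans (Set.ncard_le_ncard (Set.inter_subset_inter_right _ (closedBall_subset_closedBall hrρ.le))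
        (P.finite_toSet.inter_of_left _))
    have h2 : (k : ℝ) ≤ ((↑P ∩ closedBall c ρ : Set _).ncard : ℝ) := by exact_mod_cast h1
    refine le_trans ?_ (hkge.trans h2)
    rw [div_mul_eq_mul_div, one_mul]
    gcongr; norm_num
  · have h1 : (↑P ∩ closedBall c ρ : Set _).ncard ≤ K * k :=
      (Set.ncard_le_ncard (Set.inter_subset_inter_right _ (closedBall_subset_closedBall hρ2r))
        (P.finite_toSet.inter_of_left _)).trans hout
    have h2 := Set.ncard_inter_add_ncard_diff_eq_ncard (↑P : Set (EuclideanSpace ℝ (Fin d)))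
      (closedBall c ρ) P.finite_toSet
    rw [Set.ncard_coe_finset, ← hn] at h2
    have h3 : ((↑P ∩ closedBall c ρ : Set _).ncard : ℝ) ≤ K * k := by exact_mod_cast h1
    have h4 : ((↑P ∩ closedBall c ρ : Set _).ncard : ℝ) + ((↑P \ closedBall c ρ : Set _).ncard : ℝ)
      = n := by exact_mod_cast h2
    have h5 : 1 / (4 * K) * (n : ℝ) ≤ n / 4 := by
      rw [div_mul_eq_mul_div, one_mul]
      gcongr; linarith
    linarith
  · intro p₁ hp₁ hd₁ p₂ hp₂ hd₂
    rw [Set.eq_empty_iff_forall_notMem]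
    rintro x ⟨hx1, hx2⟩
    simp only [Set.mem_setOf_eq] at hx1 hx2
    have hlt₁ : dist p₁ c < ρ := lt_of_le_of_ne hd₁ (hρP' p₁ hp₁)
    rcases le_total ρ (dist x c) with hx | hx
    · suffices h : ∃ g ∈ Γ, dist x g < dist x p₁ by
        obtain ⟨g, hg, hlt⟩ := h
        exact absurd (hx1 g (Or.inr hg)) (not_le.2 hlt)
      by_cases hc : |dist p₁ c - ρ| < r / (4 * m)
      · obtain ⟨g, hg, hlt⟩ := hFin p₁ hlt₁ x hx
        exact ⟨g, Finset.mem_biUnion.2 ⟨p₁, hnear p₁ (Finset.mem_union_left _ hp₁) hc, hg⟩, hlt⟩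
      · obtain ⟨g, hg, hlt⟩ := hnet2 x
        refine ⟨g, hg, hlt.trans_le ?_⟩
        rw [abs_of_nonpos (by linarith)] at hc
        rw [abs_of_nonneg (by linarith)]
        have := dist_triangle x p₁ c
        linarith
    · suffices h : ∃ g ∈ Γ, dist x g < dist x p₂ by
        obtain ⟨g, hg, hlt⟩ := h
        exact absurd (hx2 g (Or.inr hg)) (not_le.2 hlt)
      by_cases hc : |dist p₂ c - ρ| < r / (4 * m)
      · obtain ⟨g, hg, hlt⟩ := hFout p₂ hd₂ x hx
        exact ⟨g, Finset.mem_biUnion.2 ⟨p₂, hnear p₂ (Finset.mem_union_left _ hp₂) hc, hg⟩, hlt⟩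
      · obtain ⟨g, hg, hlt⟩ := hnet2 x
        refine ⟨g, hg, hlt.trans_le ?_⟩
        rw [abs_of_nonneg (by linarith)] at hc
        rw [abs_of_nonpos (by linarith)]
        have := dist_triangle_left p₂ c x
        linarith
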